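/- arXiv:1301.1993 — 4 statements merged into one kernel-verified Lean document; each statement's English description precedes it below -/
import Mathlib

section
/- Let C ⊆ ℝⁿ be a cone based at y ∈ ℝⁿ and let Σ ⊆ ℝⁿ be any set. Then for any r > 0 such that B(y,r) ∩ Σ ≠ ∅: (i) d^{y,r}(Σ,C) = d̃^{y,r}(Σ,C); (ii) d̃^{y,r}(C,Σ) ≤ d^{y,r}(C,Σ) ≤ 2·d̃^{y,r}(C,Σ); and in particular (iii) D̃^{y,r}(C,Σ) ≤ D^{y,r}(C,Σ) ≤ 2·D̃^{y,r}(C,Σ). -/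
open Metric Set MeasureTheory Filter Module
open scoped RealInnerProductSpace Topology Pointwise ENNReal

noncomputable section

/-- `ℝⁿ` as a Euclidean space. -/
abbrev E (n : ℕ) : Type := EuclideanSpace ℝ (Fin n)

/-- `d(A,B) = sup_{a ∈ A} inf_{b ∈ B} |a - b|`. -/
def setD {n : ℕ} (A B : Set (E n)) : ℝ := ⨆ a ∈ A, Metric.infDist a B

/-- `d^{x,r}(A,B) = (1/r) d(A ∩ B(x,r), B ∩ B(x,r))`. -/
def dxr {n : ℕ} (x : E n) (r : ℝ) (A B : Set (E n)) : ℝ :=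
  (1 / r) * setD (A ∩ closedBall x r) (B ∩ closedBall x r)

/-- `D^{x,r}(A,B) = max(d^{x,r}(A,B), d^{x,r}(B,A))`. -/
def Dxr {n : ℕ} (x : E n) (r : ℝ) (A B : Set (E n)) : ℝ :=
  max (dxr x r A B) (dxr x r B A)

/-- `d̃^{x,r}(A,B) = (1/r) d(A ∩ B(x,r), B)`. -/
def dtxr {n : ℕ} (x : E n) (r : ℝ) (A B : Set (E n)) : ℝ :=
  (1 / r) * setD (A ∩ closedBall x r) B

/-- `D̃^{x,r}(A,B) = max(d̃^{x,r}(A,B), d̃^{x,r}(B,A))`. -/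
def Dtxr {n : ℕ} (x : E n) (r : ℝ) (A B : Set (E n)) : ℝ :=
  max (dtxr x r A B) (dtxr x r B A)

/-- `C` is a cone based at `y`: `y ∈ C` and `s • (C − y) = C − y` for all `s > 0`. -/
def IsConeAt {n : ℕ} (y : E n) (C : Set (E n)) : Prop :=
  y ∈ C ∧ ∀ s : ℝ, 0 < s → s • {z : E n | y + z ∈ C} = {z : E n | y + z ∈ C}

/-- The standard KP cone `{x₄² = x₁² + x₂² + x₃²}` in `ℝⁿ`, `n ≥ 4`. -/
def stdKP (n : ℕ) (hn : 4 ≤ n) : Set (E n) :=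
  {x : E n | (x ⟨3, by omega⟩) ^ 2 =
    (x ⟨0, by omega⟩) ^ 2 + (x ⟨1, by omega⟩) ^ 2 + (x ⟨2, by omega⟩) ^ 2}

/-- `C` is a KP cone based at `y`: in some orthonormal coordinates centered at the origin,
`C − y` is the standard KP cone. -/
def IsKPCone {n : ℕ} (hn : 4 ≤ n) (y : E n) (C : Set (E n)) : Prop :=
  ∃ f : E n ≃ₗᵢ[ℝ] E n, {z : E n | y + z ∈ C} = f ⁻¹' stdKP n hn

/-- `θ^P_Σ(x,r)` : best approximation of `S` in `B(x,r)` by affine `m`-planes through `x`. -/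
def thetaP {n : ℕ} (m : ℕ) (S : Set (E n)) (x : E n) (r : ℝ) : ℝ :=
  ⨅ L : {L : AffineSubspace ℝ (E n) // x ∈ L ∧ Module.finrank ℝ L.direction = m},
    Dxr x r S (L.1 : Set (E n))

/-- `θ^C_Σ(x,r)` : best approximation of `S` in `B(x,r)` by KP cones based at `x`. -/
def thetaC {n : ℕ} (hn : 4 ≤ n) (S : Set (E n)) (x : E n) (r : ℝ) : ℝ :=
  ⨅ C : {C : Set (E n) // IsKPCone hn x C}, Dxr x r S C.1

/-- `ϑ^C_Σ(x,r)` : best approximation of `S` in `B(x,r)` by KP cones containing `x`. -/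
def varthetaC {n : ℕ} (hn : 4 ≤ n) (S : Set (E n)) (x : E n) (r : ℝ) : ℝ :=
  ⨅ C : {C : Set (E n) // (∃ y, IsKPCone hn y C) ∧ x ∈ C}, Dxr x r S C.1

/-- The angle `∠(P₁,P₂) = arcsin Γ(P₁,P₂)` between two affine planes. -/
def planeAngle {n : ℕ} (P₁ P₂ : AffineSubspace ℝ (E n)) : ℝ :=
  Real.arcsin (dxr (0 : E n) 1 (P₁.direction : Set (E n)) (P₂.direction : Set (E n)))

/-- The support of a measure. -/
def msupp {n : ℕ} (μ : Measure (E n)) : Set (E n) :=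
  {x : E n | ∀ r : ℝ, 0 < r → 0 < μ (closedBall x r)}

/-- Weak convergence of a sequence of measures in the sense of Radon measures. -/
def VagueTendsto {n : ℕ} (μs : ℕ → Measure (E n)) (ν : Measure (E n)) : Prop :=
  ∀ f : E n → ℝ, Continuous f → HasCompactSupport f →
    Tendsto (fun i => ∫ y, f y ∂(μs i)) atTop (nhds (∫ y, f y ∂ν))

/-- `ν` is a tangent measure of `μ` at `x`: `ν ≠ 0` and for some `rᵢ ↓ 0`, `cᵢ > 0`,
`cᵢ (T_{x,rᵢ})₊μ → ν` weakly. -/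
def IsTangentMeasure {n : ℕ} (μ ν : Measure (E n)) (x : E n) : Prop :=
  ν ≠ 0 ∧ ∃ r c : ℕ → ℝ, (∀ i, 0 < r i) ∧ Tendsto r atTop (nhds 0) ∧ (∀ i, 0 < c i) ∧
    VagueTendsto (fun i => ENNReal.ofReal (c i) • Measure.map (fun y => (r i)⁻¹ • (y - x)) μ) ν

/-- `μ` is `m`-asymptotically optimally doubling. -/
def AOD {n : ℕ} (m : ℕ) (μ : Measure (E n)) : Prop :=
  ∀ K : Set (E n), K ⊆ msupp μ → IsCompact K → ∀ δ : ℝ, 0 < δ →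
    ∃ r₀ : ℝ, 0 < r₀ ∧ ∀ x ∈ K, ∀ r : ℝ, 0 < r → r ≤ r₀ →
      ∀ τ : ℝ, τ ∈ Set.Icc (1/2 : ℝ) 1 →
        |(μ (closedBall x (τ * r))).toReal / (μ (closedBall x r)).toReal - τ ^ m| < δ

/-- `ν` is `m`-flat: `m`-dimensional Hausdorff measure restricted to an affine `m`-plane. -/
def IsFlatMeasure {n : ℕ} (m : ℕ) (ν : Measure (E n)) : Prop :=
  ∃ L : AffineSubspace ℝ (E n), (L : Set (E n)).Nonempty ∧
    Module.finrank ℝ L.direction = m ∧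
    ν = (Measure.hausdorffMeasure (m : ℝ)).restrict (L : Set (E n))

/-- Volume of the unit ball in `ℝᵐ`. -/
def unitBallVol (m : ℕ) : ℝ := (volume (Metric.ball (0 : EuclideanSpace ℝ (Fin m)) 1)).toReal

/-- `ω₃`, the volume of the unit `3`-ball. -/
def omega3 : ℝ := unitBallVol 3

/-- The second moment `Q_{0,r}` of a measure on `ℝ⁴`. -/
def Qmom (μ : Measure (E 4)) (r : ℝ) (z : E 4) : ℝ :=
  (5 / (omega3 * r ^ 5)) * ∫ w in closedBall (0 : E 4) r, ⟪z, w⟫ ^ 2 ∂μ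

/-- Entries `q_{ij}` of the second moment matrix in given directions. -/
def qmom (μ : Measure (E 4)) (r : ℝ) (u v : E 4) : ℝ :=
  (5 / (omega3 * r ^ 5)) * ∫ w in closedBall (0 : E 4) r, ⟪u, w⟫ * ⟪v, w⟫ ∂μ

/-- `μ` is `(α,m)`-Hölder asymptotically uniform. -/
def HolderAsympUniform {n : ℕ} (α : ℝ) (m : ℕ) (μ : Measure (E n)) : Prop :=
  ∀ K : Set (E n), K ⊆ msupp μ → IsCompact K →
    ∃ C r₀ : ℝ, 0 < r₀ ∧ ∀ x ∈ K, ∀ r : ℝ, 0 < r → r ≤ r₀ →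
      |(μ (closedBall x r)).toReal / (unitBallVol m * r ^ m) - 1| ≤ C * r ^ α

/-- `φ` is a `C^{1,β}` diffeomorphism from `U` onto `U'`: a continuously differentiable bijection
with `β`-Hölder derivative whose inverse is also `C^{1,β}`. -/
def IsC1HolderDiffeoOn (β : ℝ) (U U' : Set (E 4)) (φ : E 4 → E 4) : Prop :=
  Set.BijOn φ U U' ∧
  (∀ x ∈ U, HasFDerivAt φ (fderiv ℝ φ x) x) ∧
  (∃ M : ℝ, ∀ x ∈ U, ∀ y ∈ U, ‖fderiv ℝ φ x - fderiv ℝ φ y‖ ≤ M * ‖x - y‖ ^ β) ∧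
  ∃ ψ : E 4 → E 4, Set.BijOn ψ U' U ∧
    (∀ x ∈ U, ψ (φ x) = x) ∧ (∀ y ∈ U', φ (ψ y) = y) ∧
    (∀ y ∈ U', HasFDerivAt ψ (fderiv ℝ ψ y) y) ∧
    (∃ M : ℝ, ∀ x ∈ U', ∀ y ∈ U', ‖fderiv ℝ ψ x - fderiv ℝ ψ y‖ ≤ M * ‖x - y‖ ^ β)

theorem setD_le_aux {n : ℕ} {A B : Set (E n)} {M : ℝ} (hM : 0 ≤ M)
    (h : ∀ a ∈ A, Metric.infDist a B ≤ M) : setD A B ≤ M :=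
  Real.iSup_le (fun a => Real.iSup_le (fun ha => h a ha) hM) hM

theorem setD_nonneg_aux {n : ℕ} (A B : Set (E n)) : 0 ≤ setD A B :=
  Real.iSup_nonneg (fun _ => Real.iSup_nonneg (fun _ => Metric.infDist_nonneg))

theorem le_setD_aux {n : ℕ} {A B : Set (E n)} {y : E n} {r : ℝ}
    (hA : A ⊆ closedBall y r) (hB : B.Nonempty) {a : E n} (ha : a ∈ A) :
    Metric.infDist a B ≤ setD A B := by
  obtain ⟨b, hb⟩ := hB
  have hM : ∀ x ∈ A, Metric.infDist x B ≤ |r| + dist y b := by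
    intro x hx
    have h1 := Metric.infDist_le_dist_of_mem (x := x) hb
    have h2 := dist_triangle x y b
    have h3 : dist x y ≤ r := hA hx
    have := le_abs_self r
    linarith
  have hM0 : 0 ≤ |r| + dist y b := by positivity
  have hbdd : BddAbove (Set.range fun a => ⨆ (_ : a ∈ A), Metric.infDist a B) := by
    refine ⟨|r| + dist y b, ?_⟩
    rintro _ ⟨x, rfl⟩
    exact Real.iSup_le (fun hx => hM x hx) hM0
  have := le_ciSup hbdd a
  simp only [ha, ciSup_pos] at this
  exact this

theorem cone_scale_aux {n : ℕ} {y : E n} {C : Set (E n)} (hC : IsConeAt y C) {s : ℝ}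
    (hs : 0 < s) {c : E n} (hc : c ∈ C) : y + s • (c - y) ∈ C := by
  have h : s • (c - y) ∈ s • {z : E n | y + z ∈ C} :=
    Set.smul_mem_smul_set (by simpa using hc)
  rw [hC.2 s hs] at h
  exact h

theorem cone_proj_aux {n : ℕ} (a c : E n) {r : ℝ} (hr : 0 < r) (ha : ‖a‖ ≤ r) (hc : r < ‖c‖) :
    ‖a - (r / ‖c‖) • c‖ ≤ ‖a - c‖ := by
  have hc0 : 0 < ‖c‖ := hr.trans hc
  set t := r / ‖c‖ with ht
  have ht0 : 0 < t := by positivity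
  have ht1 : t < 1 := (div_lt_one hc0).2 hc
  have htc : t * ‖c‖ = r := by rw [ht]; field_simp
  have hi : ⟪a, c⟫ ≤ r * ‖c‖ :=
    (real_inner_le_norm a c).trans (mul_le_mul_of_nonneg_right ha hc0.le)
  have hsq : ‖a - t • c‖ ^ 2 ≤ ‖a - c‖ ^ 2 := by
    rw [norm_sub_sq_real, norm_sub_sq_real, inner_smul_right, norm_smul, Real.norm_eq_abs,
      abs_of_pos ht0, htc]
    have h1 : (1 - t) * ⟪a, c⟫ ≤ (1 - t) * (r * ‖c‖) :=
      mul_le_mul_of_nonneg_left hi (by linarith)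
    have h2 : t * (r * ‖c‖) = r ^ 2 := by
      calc t * (r * ‖c‖) = r * (t * ‖c‖) := by ring
        _ = r ^ 2 := by rw [htc]; ring
    nlinarith [sq_nonneg (‖c‖ - r)]
  exact le_of_sq_le_sq hsq (norm_nonneg _)

theorem cone_infDist_aux {n : ℕ} {y : E n} {C : Set (E n)} (hC : IsConeAt y C) {r : ℝ}
    (hr : 0 < r) {a : E n} (ha : a ∈ closedBall y r) :
    Metric.infDist a (C ∩ closedBall y r) = Metric.infDist a C := by
  have hne : (C ∩ closedBall y r).Nonempty := ⟨y, hC.1, mem_closedBall_self hr.le⟩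
  apply le_antisymm
  · refine (Metric.le_infDist ⟨y, hC.1⟩).2 ?_
    intro c hc
    by_cases hcr : c ∈ closedBall y r
    · exact Metric.infDist_le_dist_of_mem ⟨hc, hcr⟩
    · rw [mem_closedBall, not_le, dist_eq_norm] at hcr
      rw [mem_closedBall, dist_eq_norm] at ha
      have h0 : 0 < ‖c - y‖ := hr.trans hcr
      have h := cone_proj_aux (a - y) (c - y) hr ha hcr
      have hm : y + (r / ‖c - y‖) • (c - y) ∈ C ∩ closedBall y r := by
        refine ⟨cone_scale_aux hC (by positivity) hc, ?_⟩
        rw [mem_closedBall, dist_eq_norm, add_sub_cancel_left, norm_smul, Real.norm_eq_abs,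
          abs_of_pos (by positivity), div_mul_cancel₀ _ h0.ne']
      refine (Metric.infDist_le_dist_of_mem hm).trans ?_
      rw [dist_eq_norm, dist_eq_norm, ← sub_sub]
      simpa using h
  · exact Metric.infDist_le_infDist_of_subset inter_subset_left hne

theorem cone_half_aux {n : ℕ} {y : E n} {C S : Set (E n)} (hC : IsConeAt y C) {r : ℝ}
    (hr : 0 < r) (hne : (S ∩ closedBall y r).Nonempty) {c : E n}
    (hc : c ∈ C ∩ closedBall y r) :
    Metric.infDist c (S ∩ closedBall y r) ≤ 2 * setD (C ∩ closedBall y r) S := by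
  have hS : S.Nonempty := hne.mono inter_subset_left
  set δ := setD (C ∩ closedBall y r) S with hδ
  have hδ0 : 0 ≤ δ := setD_nonneg_aux _ _
  have hcy : dist c y ≤ r := hc.2
  rcases le_or_gt r δ with h | h
  · obtain ⟨b, hb⟩ := hne
    have h1 := Metric.infDist_le_dist_of_mem (x := c) hb
    have h2 := dist_triangle_right c b y
    have h3 : dist b y ≤ r := hb.2
    linarith
  · refine le_of_forall_pos_lt_add ?_
    intro ε hε
    obtain ⟨t, ht1, ht2⟩ := exists_between (lt_min h (show δ < δ + ε / 2 by linarith))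
    have htr : t < r := ht2.trans_le (min_le_left _ _)
    have hte : t < δ + ε / 2 := ht2.trans_le (min_le_right _ _)
    have ht0 : 0 < t := hδ0.trans_lt ht1
    have hq : t / r < 1 := (div_lt_one hr).2 htr
    have hq0 : 0 < t / r := by positivity
    have hqr : t / r * r = t := div_mul_cancel₀ _ hr.ne'
    set c' := y + (1 - t / r) • (c - y) with hc'
    have hd1 : dist c' y ≤ r - t := by
      rw [dist_eq_norm, hc', add_sub_cancel_left, norm_smul, Real.norm_eq_abs,
        abs_of_pos (by linarith), ← dist_eq_norm]
      nlinarith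
    have hd2 : dist c c' ≤ t := by
      have : c - c' = (t / r) • (c - y) := by rw [hc']; module
      rw [dist_eq_norm, this, norm_smul, Real.norm_eq_abs, abs_of_pos hq0, ← dist_eq_norm]
      nlinarith
    have hm : c' ∈ C ∩ closedBall y r :=
      ⟨cone_scale_aux hC (by linarith) hc.1, by rw [mem_closedBall]; linarith⟩
    have hl : Metric.infDist c' S < t := (le_setD_aux inter_subset_right hS hm).trans_lt ht1
    obtain ⟨b, hb, hbt⟩ := (Metric.infDist_lt_iff hS).1 hl
    have hbm : b ∈ S ∩ closedBall y r := by
      refine ⟨hb, ?_⟩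
      rw [mem_closedBall]
      have := dist_triangle_left b y c'
      linarith
    have h1 := Metric.infDist_le_dist_of_mem (x := c) hbm
    have h2 := dist_triangle c c' b
    linarith

/-- Lemma 2.3 / `ConeG1`: comparison of `d^{y,r}`, `d̃^{y,r}` and
`D^{y,r}`, `D̃^{y,r}` when one of the sets is a cone based at `y`. -/
theorem cone_hausdorff_comparison {n : ℕ} (y : E n) (C S : Set (E n))
    (hC : IsConeAt y C) (r : ℝ) (hr : 0 < r) (hne : (S ∩ closedBall y r).Nonempty) :
    dxr y r S C = dtxr y r S C ∧
    (dtxr y r C S ≤ dxr y r C S ∧ dxr y r C S ≤ 2 * dtxr y r C S) ∧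
    (Dtxr y r C S ≤ Dxr y r C S ∧ Dxr y r C S ≤ 2 * Dtxr y r C S) := by
  have hr1 : 0 ≤ 1 / r := by positivity
  have hS : S.Nonempty := hne.mono inter_subset_left
  have h1 : dxr y r S C = dtxr y r S C := by
    unfold dxr dtxr setD
    congr 1
    refine iSup_congr fun a => iSup_congr fun ha => ?_
    exact cone_infDist_aux hC hr ha.2
  have h2 : dtxr y r C S ≤ dxr y r C S := by
    unfold dxr dtxr
    refine mul_le_mul_of_nonneg_left ?_ hr1
    refine setD_le_aux (setD_nonneg_aux _ _) fun a ha => ?_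
    exact (Metric.infDist_le_infDist_of_subset inter_subset_left hne).trans
      (le_setD_aux inter_subset_right hne ha)
  have h3 : dxr y r C S ≤ 2 * dtxr y r C S := by
    unfold dxr dtxr
    rw [mul_left_comm]
    refine mul_le_mul_of_nonneg_left ?_ hr1
    exact setD_le_aux (mul_nonneg zero_le_two (setD_nonneg_aux _ _))
      fun a ha => cone_half_aux hC hr hne ha
  have h4 : 0 ≤ dtxr y r S C := mul_nonneg hr1 (setD_nonneg_aux _ _)
  refine ⟨h1, ⟨h2, h3⟩, ?_, ?_⟩
  · unfold Dtxr Dxr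
    rw [h1]
    exact max_le_max h2 le_rfl
  · unfold Dtxr Dxr
    rw [h1]
    refine max_le ?_ ?_
    · have := le_max_left (dtxr y r C S) (dtxr y r S C)
      linarith
    · have := le_max_right (dtxr y r C S) (dtxr y r S C)
      linarith
end
end

section
/- Let C be a KP cone in ℝ⁴ based at 0. There exists a constant C₀ such that for every a ∈ C exactly one of the following holds: (1) a = 0, in which case θ^P_C(a,r) = 1/√2 for all r > 0; or (2) a ≠ 0, in which case for all 0 < r ≤ |a|/2 one has D^{a,r}(C, T_aC) ≤ C₀·r/|a| (and hence θ^P_C(a,r) ≤ C₀·r/|a|), where T_aC is the affine tangent plane to C at a (containing a). -/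
open Metric Set MeasureTheory Filter Module
open scoped RealInnerProductSpace Topology Pointwise ENNReal

noncomputable section

lemma setD_le' {A B : Set (E 4)} {M : ℝ} (hM : 0 ≤ M)
    (h : ∀ a ∈ A, ∃ b ∈ B, dist a b ≤ M) : setD A B ≤ M := by
  unfold setD
  refine Real.iSup_le (fun a => Real.iSup_le (fun ha => ?_) hM) hM
  obtain ⟨b, hb, hab⟩ := h a ha
  exact (Metric.infDist_le_dist_of_mem hb).trans hab

lemma le_setD' {A B : Set (E 4)} {M m : ℝ} (hM : 0 ≤ M)
    (h : ∀ a ∈ A, ∃ b ∈ B, dist a b ≤ M) (a : E 4) (ha : a ∈ A) (hm : m ≤ Metric.infDist a B) :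
    m ≤ setD A B := by
  unfold setD
  have hb : BddAbove (Set.range fun a => ⨆ _ : a ∈ A, Metric.infDist a B) := by
    refine ⟨M, ?_⟩
    rintro _ ⟨a, rfl⟩
    refine Real.iSup_le (fun ha => ?_) hM
    obtain ⟨b, hb, hab⟩ := h a ha
    exact (Metric.infDist_le_dist_of_mem hb).trans hab
  refine le_ciSup_of_le hb a ?_
  have : Nonempty (a ∈ A) := ⟨ha⟩
  rw [ciSup_const]
  exact hm

lemma dxr_le' {A B : Set (E 4)} {x : E 4} {r M : ℝ} (hr : 0 < r) (hM : 0 ≤ M)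
    (h : ∀ a ∈ A, ‖a - x‖ ≤ r → ∃ b ∈ B, ‖b - x‖ ≤ r ∧ ‖a - b‖ ≤ M * r) :
    dxr x r A B ≤ M := by
  unfold dxr
  have : setD (A ∩ closedBall x r) (B ∩ closedBall x r) ≤ M * r := by
    refine setD_le' (by positivity) ?_
    rintro a ⟨ha, hax⟩
    rw [mem_closedBall, dist_eq_norm] at hax
    obtain ⟨b, hb, h1, h2⟩ := h a ha hax
    refine ⟨b, ⟨hb, ?_⟩, ?_⟩
    · rwa [mem_closedBall, dist_eq_norm]
    · rwa [dist_eq_norm]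
  rw [one_div, inv_mul_le_iff₀ hr]
  linarith

lemma Dxr_nonneg' (x : E 4) (r : ℝ) (hr : 0 < r) (A B : Set (E 4)) : 0 ≤ Dxr x r A B := by
  unfold Dxr dxr setD
  refine le_max_of_le_left (mul_nonneg (by positivity) ?_)
  exact Real.iSup_nonneg fun a => Real.iSup_nonneg fun _ => Metric.infDist_nonneg

lemma thetaP_le' {S : Set (E 4)} {x : E 4} {r : ℝ} (hr : 0 < r) (L : AffineSubspace ℝ (E 4))
    (hx : x ∈ L) (hL : Module.finrank ℝ L.direction = 3) :
    thetaP 3 S x r ≤ Dxr x r S (L : Set (E 4)) := by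
  unfold thetaP
  refine ciInf_le ?_ (⟨L, hx, hL⟩ :
    {L : AffineSubspace ℝ (E 4) // x ∈ L ∧ Module.finrank ℝ L.direction = 3})
  refine ⟨0, ?_⟩
  rintro _ ⟨L, rfl⟩
  exact Dxr_nonneg' x r hr _ _

lemma normsq4 (x : E 4) : ‖x‖ ^ 2 = x 0 ^ 2 + x 1 ^ 2 + x 2 ^ 2 + x 3 ^ 2 := by
  rw [EuclideanSpace.norm_sq_eq, Fin.sum_univ_four]
  simp

lemma inner4 (x y : E 4) : inner ℝ x y = x 0 * y 0 + x 1 * y 1 + x 2 * y 2 + x 3 * y 3 := by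
  simp [PiLp.inner_apply, Fin.sum_univ_four]
  ring

lemma exists_plane (f : E 4 ≃ₗᵢ[ℝ] E 4) (ν : E 4) (hν : ν ≠ 0) :
    ∃ L : AffineSubspace ℝ (E 4), Module.finrank ℝ L.direction = 3 ∧
      (L : Set (E 4)) = {x | inner ℝ ν (f x) = 0} := by
  have : Fact (finrank ℝ (E 4) = 3 + 1) := ⟨by simp⟩
  have hν' : f.symm ν ≠ 0 := by simpa using hν
  refine ⟨(ℝ ∙ (f.symm ν))ᗮ.toAffineSubspace, ?_, ?_⟩
  · rw [Submodule.toAffineSubspace_direction]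
    exact Submodule.finrank_orthogonal_span_singleton hν'
  · ext x
    simp only [SetLike.mem_coe, Submodule.mem_toAffineSubspace, Set.mem_setOf_eq]
    rw [Submodule.mem_orthogonal_singleton_iff_inner_right, ← f.inner_map_map]
    simp

lemma mem_std (x : E 4) (h : 4 ≤ 4) :
    x ∈ stdKP 4 h ↔ x 3 ^ 2 = x 0 ^ 2 + x 1 ^ 2 + x 2 ^ 2 := Iff.rfl

def Jv (a : E 4) : E 4 := !₂[a 0, a 1, a 2, - a 3]

lemma norm_Jv (a : E 4) : ‖Jv a‖ = ‖a‖ := by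
  have : ‖Jv a‖ ^ 2 = ‖a‖ ^ 2 := by
    rw [normsq4, normsq4]; simp [Jv]
  exact (sq_eq_sq₀ (norm_nonneg _) (norm_nonneg _)).1 this

lemma inner_Jv (a x : E 4) :
    inner ℝ (Jv a) x = a 0 * x 0 + a 1 * x 1 + a 2 * x 2 - a 3 * x 3 := by
  rw [inner4]; simp [Jv]; ring

lemma core1 (a c : E 4) (h4 : 4 ≤ 4) (ha : a ∈ stdKP 4 h4) (ha0 : a ≠ 0) (hc : c ∈ stdKP 4 h4)
    (r : ℝ) (hr : 0 < r) (h : ‖c - a‖ ≤ r) :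
    ∃ t : E 4, inner ℝ (Jv a) t = 0 ∧ ‖t - a‖ ≤ r ∧ ‖c - t‖ ≤ r / ‖a‖ * r := by
  have hp : 0 < ‖a‖ := norm_pos_iff.2 ha0
  set P := inner ℝ (Jv a) c with hP
  have haJ : inner ℝ (Jv a) a = 0 := by
    rw [inner_Jv]; rw [mem_std] at ha; linarith
  have hP2 : |P| ≤ r ^ 2 := by
    rw [mem_std] at ha hc
    have h2 : ‖c - a‖ ^ 2 ≤ r ^ 2 := by gcongr
    rw [normsq4] at h2
    simp only [PiLp.sub_apply] at h2
    rw [hP, inner_Jv, abs_le]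
    constructor <;>
    nlinarith [sq_nonneg (c 0 - a 0), sq_nonneg (c 1 - a 1), sq_nonneg (c 2 - a 2),
      sq_nonneg (c 3 - a 3)]
  set l := P / ‖a‖ ^ 2 with hl
  have hlP : l * ‖a‖ ^ 2 = P := by rw [hl]; field_simp
  refine ⟨c - l • Jv a, ?_, ?_, ?_⟩
  · rw [inner_sub_right, inner_smul_right, real_inner_self_eq_norm_sq, norm_Jv, hlP]; ring
  · refine le_trans ?_ h
    refine (sq_le_sq₀ (norm_nonneg _) (norm_nonneg _)).1 ?_
    have : c - l • Jv a - a = (c - a) - l • Jv a := by abel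
    rw [this, norm_sub_sq_real, inner_smul_right, real_inner_comm, inner_sub_right, haJ,
      norm_smul, mul_pow, norm_Jv, ← hP, ← hlP, Real.norm_eq_abs, sq_abs]
    nlinarith [sq_nonneg (l * ‖a‖)]
  · rw [sub_sub_cancel, norm_smul, norm_Jv, Real.norm_eq_abs, hl, abs_div,
      abs_of_pos (by positivity : 0 < ‖a‖ ^ 2)]
    rw [div_mul_eq_mul_div, div_mul_eq_mul_div, div_le_div_iff₀ (by positivity) hp]
    nlinarith [mul_le_mul_of_nonneg_right hP2 (by positivity : 0 ≤ ‖a‖ ^ 2)]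

lemma corereal (a0 a1 a2 a3 h0 h1 h2 h3 n : ℝ) (hn : 0 ≤ n) (h3p : 0 < a3)
    (hn2 : n ^ 2 = a0 ^ 2 + a1 ^ 2 + a2 ^ 2 + a3 ^ 2) (hc : a3 ^ 2 = a0 ^ 2 + a1 ^ 2 + a2 ^ 2)
    (hh : h0 ^ 2 + h1 ^ 2 + h2 ^ 2 + h3 ^ 2 ≤ n ^ 2 / 4)
    (hT : a0 * h0 + a1 * h1 + a2 * h2 - a3 * h3 = 0) :
    ∃ w, w ^ 2 = (a0 + h0) ^ 2 + (a1 + h1) ^ 2 + (a2 + h2) ^ 2 ∧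
      |w - (a3 + h3)| * n ≤ 8 * (h0 ^ 2 + h1 ^ 2 + h2 ^ 2 + h3 ^ 2) := by
  set u := (a0 + h0) ^ 2 + (a1 + h1) ^ 2 + (a2 + h2) ^ 2 with hu
  have hu0 : 0 ≤ u := by positivity
  have hs := Real.sq_sqrt hu0
  have hw := Real.sqrt_nonneg u
  set w := √u
  refine ⟨w, hs, ?_⟩
  have hs' : a3 / 4 ≤ a3 + h3 := by
    have : h3 ^ 2 ≤ (3 / 4 * a3) ^ 2 := by nlinarith [sq_nonneg h0, sq_nonneg h1, sq_nonneg h2]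
    have := (abs_le_of_sq_le_sq' this (by positivity)).1
    linarith
  have hna : n ≤ 2 * a3 := by
    refine (sq_le_sq₀ hn (by linarith)).1 ?_
    nlinarith
  have hq : |w - (a3 + h3)| * (w + (a3 + h3)) ≤ h0 ^ 2 + h1 ^ 2 + h2 ^ 2 + h3 ^ 2 := by
    rw [← abs_of_pos (by linarith : 0 < w + (a3 + h3)), ← abs_mul, abs_le]
    constructor <;> nlinarith [sq_nonneg h0, sq_nonneg h1, sq_nonneg h2, sq_nonneg h3]
  have hab := abs_nonneg (w - (a3 + h3))
  nlinarith [mul_le_mul_of_nonneg_left hna hab,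
    mul_le_mul_of_nonneg_left (by linarith : a3 / 4 ≤ w + (a3 + h3)) hab]

lemma core2 (a h : E 4) (h4 : 4 ≤ 4) (ha : a ∈ stdKP 4 h4) (ha0 : a ≠ 0)
    (hh : ‖h‖ ≤ ‖a‖ / 2) (hT : inner ℝ (Jv a) h = 0) :
    ∃ c ∈ stdKP 4 h4, ‖a + h - c‖ * ‖a‖ ≤ 8 * ‖h‖ ^ 2 := by
  rw [mem_std] at ha
  rw [inner_Jv] at hT
  have hp : 0 < ‖a‖ := norm_pos_iff.2 ha0
  have hn := normsq4 a
  have hh2 : ‖h‖ ^ 2 ≤ ‖a‖ ^ 2 / 4 := by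
    have : ‖h‖ ^ 2 ≤ (‖a‖ / 2) ^ 2 := by gcongr
    linarith
  have key : ∃ w, w ^ 2 = (a 0 + h 0) ^ 2 + (a 1 + h 1) ^ 2 + (a 2 + h 2) ^ 2 ∧
      |w - (a 3 + h 3)| * ‖a‖ ≤ 8 * ‖h‖ ^ 2 := by
    rw [normsq4 h] at hh2 ⊢
    rcases lt_trichotomy (a 3) 0 with h3 | h3 | h3
    · obtain ⟨w, h1, h2⟩ := corereal (a 0) (a 1) (a 2) (-a 3) (h 0) (h 1) (h 2) (-h 3) ‖a‖ hp.le
        (by linarith) (by linarith) (by linarith) (by linarith) (by linarith)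
      refine ⟨-w, by linarith, ?_⟩
      rw [← abs_neg]
      rw [neg_sq] at h2
      convert h2 using 3
      ring
    · rw [h3] at ha hn
      nlinarith
    · exact corereal _ _ _ _ _ _ _ _ ‖a‖ hp.le h3 hn ha hh2 hT
  obtain ⟨w, hw1, hw2⟩ := key
  refine ⟨!₂[a 0 + h 0, a 1 + h 1, a 2 + h 2, w], ?_, ?_⟩
  · rw [mem_std]; simpa using hw1
  · have : ‖a + h - !₂[a 0 + h 0, a 1 + h 1, a 2 + h 2, w]‖ = |w - (a 3 + h 3)| := by
      rw [← Real.sqrt_sq (norm_nonneg _), normsq4, ← Real.sqrt_sq_eq_abs]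
      congr 1
      simp
      ring
    rw [this]; exact hw2

lemma core3 (a t : E 4) (h4 : 4 ≤ 4) (ha : a ∈ stdKP 4 h4) (ha0 : a ≠ 0)
    (hT : inner ℝ (Jv a) t = 0)
    (r : ℝ) (hr : 0 < r) (hra : r ≤ ‖a‖ / 2) (h : ‖t - a‖ ≤ r) :
    ∃ c ∈ stdKP 4 h4, ‖c - a‖ ≤ r ∧ ‖t - c‖ ≤ 16 * r / ‖a‖ * r := by
  have hp : 0 < ‖a‖ := norm_pos_iff.2 ha0
  have haJ : inner ℝ (Jv a) a = 0 := by
    rw [inner_Jv]; rw [mem_std] at ha; linarith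
  set e := 8 * r / ‖a‖ with he
  have he0 : 0 < e := by positivity
  have h16 : 16 * r / ‖a‖ * r = 2 * (e * r) := by rw [he]; ring
  rw [h16]
  rcases le_or_gt 1 e with h1 | h1
  · refine ⟨a, ha, by simpa using hr.le, ?_⟩
    nlinarith
  · have hn : ‖(1 - e) • (t - a)‖ = (1 - e) * ‖t - a‖ := by
      rw [norm_smul, Real.norm_eq_abs, abs_of_pos (by linarith)]
    have hn2 : ‖(1 - e) • (t - a)‖ ≤ r := by
      rw [hn]; nlinarith [norm_nonneg (t - a)]
    obtain ⟨c, hc, hc2⟩ := core2 a ((1 - e) • (t - a)) h4 ha ha0 (by linarith)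
      (by rw [inner_smul_right, inner_sub_right, hT, haJ]; ring)
    have hc3 : ‖a + (1 - e) • (t - a) - c‖ ≤ e * r := by
      have : ‖(1 - e) • (t - a)‖ ^ 2 ≤ r ^ 2 := by gcongr
      rw [he, div_mul_eq_mul_div, le_div_iff₀ hp]
      nlinarith
    refine ⟨c, hc, ?_, ?_⟩
    · calc ‖c - a‖ = ‖(1 - e) • (t - a) - (a + (1 - e) • (t - a) - c)‖ := by congr 1; abel
        _ ≤ _ := norm_sub_le _ _
        _ ≤ (1 - e) * r + e * r := by
          rw [hn]; gcongr
        _ = r := by ring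
    · calc ‖t - c‖ = ‖e • (t - a) + (a + (1 - e) • (t - a) - c)‖ := by
            congr 1; rw [sub_smul, one_smul]; abel
        _ ≤ _ := norm_add_le _ _
        _ ≤ e * r + e * r := by
          rw [norm_smul, Real.norm_eq_abs, abs_of_pos he0]; gcongr
        _ = _ := by ring

lemma exists_far (ν : E 4) (hν : ‖ν‖ = 1) (h4 : 4 ≤ 4) (r : ℝ) (hr : 0 < r) :
    ∃ c ∈ stdKP 4 h4, ‖c‖ ≤ r ∧ 1 / √2 * r ≤ inner ℝ ν c := by
  have hn := normsq4 ν
  rw [hν] at hn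
  have h2 : (1 / √2) ^ 2 = 1 / 2 := by rw [div_pow, Real.sq_sqrt (by norm_num)]; norm_num
  have h2p : 0 < 1 / √2 := by positivity
  set k := 1 / √2
  -- unit vector w and sign
  set m := √(ν 0 ^ 2 + ν 1 ^ 2 + ν 2 ^ 2) with hm
  have hm2 : m ^ 2 = ν 0 ^ 2 + ν 1 ^ 2 + ν 2 ^ 2 := Real.sq_sqrt (by positivity)
  have hm0 : 0 ≤ m := Real.sqrt_nonneg _
  have hw : ∃ w0 w1 w2 : ℝ, w0 ^ 2 + w1 ^ 2 + w2 ^ 2 = 1 ∧ ν 0 * w0 + ν 1 * w1 + ν 2 * w2 = m := by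
    rcases hm0.eq_or_lt with h | h
    · refine ⟨1, 0, 0, by norm_num, ?_⟩
      rw [← h] at hm2 ⊢
      have : ν 0 = 0 := by
        apply pow_eq_zero_iff (two_ne_zero) |>.1
        nlinarith [sq_nonneg (ν 0), sq_nonneg (ν 1), sq_nonneg (ν 2)]
      simp [this]
    · refine ⟨ν 0 / m, ν 1 / m, ν 2 / m, ?_, ?_⟩
      · field_simp; linarith
      · field_simp; linarith
  obtain ⟨w0, w1, w2, hw1, hw2⟩ := hw
  have hs : ∃ s : ℝ, s ^ 2 = 1 ∧ ν 3 * s = |ν 3| := by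
    rcases le_total 0 (ν 3) with h | h
    · exact ⟨1, by norm_num, by rw [abs_of_nonneg h]; ring⟩
    · exact ⟨-1, by norm_num, by rw [abs_of_nonpos h]; ring⟩
  obtain ⟨s, hs1, hs2⟩ := hs
  refine ⟨!₂[k * r * w0, k * r * w1, k * r * w2, k * r * s], ?_, ?_, ?_⟩
  · rw [mem_std]; simp
    linear_combination (k * r) ^ 2 * hs1 - (k * r) ^ 2 * hw1
  · refine (sq_le_sq₀ (norm_nonneg _) hr.le).1 (le_of_eq ?_)
    rw [normsq4]; simp
    linear_combination (k * r) ^ 2 * hs1 + (k * r) ^ 2 * hw1 + 2 * r ^ 2 * h2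
  · rw [inner4]; simp
    have : 1 ≤ m + |ν 3| := by
      nlinarith [sq_abs (ν 3), abs_nonneg (ν 3), mul_nonneg hm0 (abs_nonneg (ν 3))]
    have e : ν 0 * (k * r * w0) + ν 1 * (k * r * w1) + ν 2 * (k * r * w2) + ν 3 * (k * r * s)
      = k * r * (m + |ν 3|) := by rw [← hw2, ← hs2]; ring
    rw [e]
    nlinarith [mul_pos h2p hr]

lemma theta_zero (f : E 4 ≃ₗᵢ[ℝ] E 4) (h4 : 4 ≤ 4) (r : ℝ) (hr : 0 < r) :
    thetaP 3 (f ⁻¹' stdKP 4 h4) 0 r = 1 / √2 := by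
  have h2 : (1 / √2) ^ 2 = 1 / 2 := by rw [div_pow, Real.sq_sqrt (by norm_num)]; norm_num
  have h2p : 0 < 1 / √2 := by positivity
  obtain ⟨L₀, hL₀, hL₀'⟩ := exists_plane f (!₂[0, 0, 0, 1]) (by
    intro h; have := congrArg (fun x : E 4 => x 3) h; simp at this)
  have hmemL : ∀ x, x ∈ (L₀ : Set (E 4)) ↔ f x 3 = 0 := by
    intro x; rw [hL₀', Set.mem_setOf_eq, inner4]; simp
  apply le_antisymm
  · refine (thetaP_le' hr L₀ ((hmemL 0).2 (by simp)) hL₀).trans ?_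
    unfold Dxr
    refine max_le (dxr_le' hr h2p.le ?_) (dxr_le' hr h2p.le ?_)
    · intro c hc hcr
      rw [sub_zero, ← f.norm_map] at hcr
      have hc' : (f c) 3 ^ 2 = (f c) 0 ^ 2 + (f c) 1 ^ 2 + (f c) 2 ^ 2 := hc
      have hn := normsq4 (f c)
      have hn2 : ‖f c‖ ^ 2 ≤ r ^ 2 := by gcongr
      refine ⟨f.symm !₂[f c 0, f c 1, f c 2, 0], ?_, ?_, ?_⟩
      · rw [hmemL]; simp
      · rw [sub_zero, f.symm.norm_map]
        refine (sq_le_sq₀ (norm_nonneg _) hr.le).1 ?_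
        rw [normsq4]; simp
        nlinarith [sq_nonneg (f c 3)]
      · rw [← f.norm_map, map_sub, f.apply_symm_apply]
        refine (sq_le_sq₀ (norm_nonneg _) (by positivity)).1 ?_
        rw [normsq4, mul_pow, h2]; simp
        linarith
    · intro l hl hlr
      rw [sub_zero, ← f.norm_map] at hlr
      rw [hmemL] at hl
      have hn := normsq4 (f l)
      have hn2 : ‖f l‖ ^ 2 ≤ r ^ 2 := by gcongr
      have hk : (‖f l‖ / 2) ^ 2 = ((f l) 0 ^ 2 + (f l) 1 ^ 2 + (f l) 2 ^ 2) / 4 := by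
        rw [div_pow, hn, hl]; ring
      rw [f.norm_map] at hn hn2 hk
      refine ⟨f.symm !₂[f l 0 / 2, f l 1 / 2, f l 2 / 2, ‖f l‖ / 2], ?_, ?_, ?_⟩
      · rw [Set.mem_preimage, f.apply_symm_apply, mem_std]
        simp
        linarith
      · rw [sub_zero, f.symm.norm_map]
        refine (sq_le_sq₀ (norm_nonneg _) hr.le).1 ?_
        rw [normsq4]; simp
        nlinarith [sq_nonneg (f l 3)]
      · rw [← f.norm_map, map_sub, f.apply_symm_apply]
        refine (sq_le_sq₀ (norm_nonneg _) (by positivity)).1 ?_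
        rw [normsq4, mul_pow, h2]; simp
        rw [hl] at hn ⊢
        nlinarith
  · unfold thetaP
    have : Nonempty {L : AffineSubspace ℝ (E 4) //
        (0 : E 4) ∈ L ∧ Module.finrank ℝ L.direction = 3} :=
      ⟨⟨L₀, (hmemL 0).2 (by simp), hL₀⟩⟩
    refine le_ciInf ?_
    rintro ⟨L, hL0, hLd⟩
    refine le_max_of_le_left ?_
    have hne : L.direction ≠ ⊤ := by
      intro h; rw [h, finrank_top] at hLd; simp at hLd
    have hne' : L.directionᗮ ≠ ⊥ := by
      intro h; exact hne (Submodule.orthogonal_eq_bot_iff.1 h)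
    obtain ⟨ν', hν', hν0⟩ := Submodule.exists_mem_ne_zero_of_ne_bot hne'
    obtain ⟨ν, hν, hν1⟩ : ∃ ν ∈ L.directionᗮ, ‖ν‖ = 1 :=
      ⟨‖ν'‖⁻¹ • ν', Submodule.smul_mem _ _ hν', by
        rw [norm_smul, norm_inv, norm_norm, inv_mul_cancel₀ (norm_ne_zero_iff.2 hν0)]⟩
    obtain ⟨c, hc, hcr, hci⟩ := exists_far (f ν) (by rw [f.norm_map, hν1]) h4 r hr
    unfold dxr
    rw [one_div_mul_eq_div, le_div_iff₀ hr]
    have h0B : (0 : E 4) ∈ (L : Set (E 4)) ∩ closedBall 0 r := ⟨hL0, by simp [hr.le]⟩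
    refine le_setD' hr.le ?_ (f.symm c) ⟨?_, ?_⟩ ?_
    · rintro x ⟨-, hx⟩
      exact ⟨0, h0B, hx⟩
    · simpa using hc
    · simpa using hcr
    · refine (Metric.le_infDist ⟨0, h0B⟩).2 ?_
      rintro l ⟨hl, -⟩
      have hl' : l ∈ L.direction := by
        have := AffineSubspace.vsub_mem_direction hl hL0
        simpa using this
      have h3 : inner ℝ ν (f.symm c - l) = inner ℝ (f ν) c := by
        rw [inner_sub_right, (Submodule.mem_orthogonal' _ _).1 hν l hl', sub_zero,
          ← f.inner_map_map, f.apply_symm_apply]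
      rw [dist_eq_norm]
      have := real_inner_le_norm ν (f.symm c - l)
      rw [h3, hν1, one_mul] at this
      linarith

/-- Lemma 2.7 / `KPflat1`: flatness of a KP cone based at `0` in `ℝ⁴`.
A KP cone based at `0` is parametrized by a linear isometry `f`, via
`C = f ⁻¹' stdKP`, and its affine tangent plane at `a ≠ 0` is
`{x | (fa)₄(fx)₄ = (fa)₁(fx)₁ + (fa)₂(fx)₂ + (fa)₃(fx)₃}`. -/
theorem kp_cone_flatness :
    ∃ C₀ : ℝ, 0 < C₀ ∧ ∀ f : E 4 ≃ₗᵢ[ℝ] E 4, ∀ C : Set (E 4),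
      C = f ⁻¹' stdKP 4 (by norm_num) →
      ((∀ r : ℝ, 0 < r → thetaP 3 C 0 r = 1 / Real.sqrt 2) ∧
       (∀ a ∈ C, a ≠ 0 → ∀ r : ℝ, 0 < r → r ≤ ‖a‖ / 2 →
          Dxr a r C
            {x : E 4 | f a 3 * f x 3 = f a 0 * f x 0 + f a 1 * f x 1 + f a 2 * f x 2}
            ≤ C₀ * r / ‖a‖ ∧
          thetaP 3 C a r ≤ C₀ * r / ‖a‖)) := by
  refine ⟨16, by norm_num, ?_⟩
  rintro f C rfl
  refine ⟨fun r hr => theta_zero f _ r hr, ?_⟩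
  intro a ha ha0 r hr hra
  have hfa : f a ∈ stdKP 4 (by norm_num) := ha
  have hfa0 : f a ≠ 0 := by simpa using ha0
  have hp : 0 < ‖a‖ := norm_pos_iff.2 ha0
  have hT : {x : E 4 | f a 3 * f x 3 = f a 0 * f x 0 + f a 1 * f x 1 + f a 2 * f x 2}
      = {x | inner ℝ (Jv (f a)) (f x) = 0} := by
    ext x
    rw [Set.mem_setOf_eq, Set.mem_setOf_eq, inner_Jv, sub_eq_zero, eq_comm]
  have hM : 0 ≤ 16 * r / ‖a‖ := by positivity
  have main : Dxr a r (f ⁻¹' stdKP 4 (by norm_num)) {x | inner ℝ (Jv (f a)) (f x) = 0}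
      ≤ 16 * r / ‖a‖ := by
    unfold Dxr
    refine max_le (dxr_le' hr hM ?_) (dxr_le' hr hM ?_)
    · intro c hc hcr
      rw [← f.norm_map, map_sub] at hcr
      obtain ⟨t, h1, h2, h3⟩ := core1 (f a) (f c) _ hfa hfa0 hc r hr hcr
      refine ⟨f.symm t, by simpa using h1, ?_, ?_⟩
      · rwa [← f.norm_map, map_sub, f.apply_symm_apply]
      · rw [← f.norm_map, map_sub, f.apply_symm_apply]
        rw [f.norm_map a] at h3
        refine h3.trans ?_
        gcongr
        linarith
    · intro t ht htr
      rw [← f.norm_map, map_sub] at htr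
      obtain ⟨c, h1, h2, h3⟩ := core3 (f a) (f t) _ hfa hfa0 ht r hr (by rwa [f.norm_map]) htr
      refine ⟨f.symm c, by simpa using h1, ?_, ?_⟩
      · rwa [← f.norm_map, map_sub, f.apply_symm_apply]
      · rw [← f.norm_map, map_sub, f.apply_symm_apply]
        rwa [f.norm_map a] at h3
  rw [hT]
  refine ⟨main, ?_⟩
  obtain ⟨L, hL, hL'⟩ := exists_plane f (Jv (f a)) (by
    rw [← norm_pos_iff, norm_Jv, f.norm_map]; exact hp)
  rw [← hL'] at main
  refine (thetaP_le' hr L ?_ hL).trans main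
  rw [← SetLike.mem_coe, hL', Set.mem_setOf_eq, inner_Jv]
  rw [mem_std] at hfa
  linarith
end
end

section
/- For every δ > 0 there exist ε > 0 and η > 0 with the following property. Let Σ ⊆ ℝ⁴, x ∈ Σ and r > 0 satisfy sup_{0 < r' ≤ r} ϑ^C_Σ(x,r') < ε. If moreover θ^P_Σ(x,r) < η, then sup_{0 < r' ≤ r} θ^P_Σ(x,r') < δ. -/
open Metric Set MeasureTheory Filter Module
open scoped RealInnerProductSpace Topology Pointwise ENNReal

noncomputable section

lemma biSup_le_aux {n : ℕ} {A B : Set (E n)} {x : E n} {r : ℝ} (hA : A ⊆ closedBall x r)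
    (hx : x ∈ B) (a : E n) (ha : a ∈ A) : Metric.infDist a B ≤ setD A B := by
  unfold setD
  have hb : ∀ a, (⨆ (_ : a ∈ A), Metric.infDist a B) ≤ max r 0 := by
    intro a
    apply Real.iSup_le _ (le_max_right _ _)
    intro h
    exact (Metric.infDist_le_dist_of_mem hx).trans ((mem_closedBall.1 (hA h)).trans (le_max_left _ _))
  have h1 := le_ciSup (f := fun a => ⨆ (_ : a ∈ A), Metric.infDist a B)
    ⟨max r 0, by rintro _ ⟨a, rfl⟩; exact hb a⟩ a
  refine le_trans ?_ h1
  simp [ha]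

lemma dxr_nonneg {n : ℕ} {A B : Set (E n)} {x : E n} {r : ℝ} (hr : 0 < r) : 0 ≤ dxr x r A B := by
  unfold dxr setD
  apply mul_nonneg (by positivity)
  apply Real.iSup_nonneg
  intro a
  apply Real.iSup_nonneg
  intro h
  exact Metric.infDist_nonneg

lemma dxr_lt_ex {n : ℕ} {A B : Set (E n)} {x : E n} {r c : ℝ} (hr : 0 < r) (hB : x ∈ B)
    (h : dxr x r A B < c) (a : E n) (ha : a ∈ A) (har : ‖a - x‖ ≤ r) :
    ∃ b ∈ B, ‖b - x‖ ≤ r ∧ ‖a - b‖ < c * r := by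
  have hxB : x ∈ B ∩ closedBall x r := ⟨hB, mem_closedBall_self hr.le⟩
  have h1 := biSup_le_aux (A := A ∩ closedBall x r) (x := x) (r := r) inter_subset_right hxB a
    ⟨ha, by rwa [mem_closedBall, dist_eq_norm]⟩
  have h2 : setD (A ∩ closedBall x r) (B ∩ closedBall x r) < c * r := by
    unfold dxr at h
    rw [one_div, inv_mul_lt_iff₀ hr] at h
    linarith
  obtain ⟨b, hb, hd⟩ := (Metric.infDist_lt_iff ⟨x, hxB⟩).1 (h1.trans_lt h2)
  exact ⟨b, hb.1, by simpa [mem_closedBall, dist_eq_norm] using hb.2, by rwa [← dist_eq_norm]⟩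

lemma dxr_le_of {n : ℕ} {A B : Set (E n)} {x : E n} {r c : ℝ} (hr : 0 < r) (hc : 0 ≤ c)
    (h : ∀ a ∈ A, ‖a - x‖ ≤ r → ∃ b ∈ B, ‖b - x‖ ≤ r ∧ ‖a - b‖ ≤ c * r) :
    dxr x r A B ≤ c := by
  unfold dxr setD
  rw [one_div, inv_mul_le_iff₀ hr]
  have hcr : 0 ≤ r * c := by positivity
  apply Real.iSup_le _ hcr
  intro a
  apply Real.iSup_le _ hcr
  intro ha
  obtain ⟨b, hb, hbr, hd⟩ := h a ha.1 (by simpa [mem_closedBall, dist_eq_norm] using ha.2)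
  refine (Metric.infDist_le_dist_of_mem (s := B ∩ closedBall x r) (y := b)
    ⟨hb, by rwa [mem_closedBall, dist_eq_norm]⟩).trans ?_
  rw [dist_eq_norm]; linarith

lemma kp_quad {y : E 4} {C : Set (E 4)} (h : IsKPCone (le_refl 4) y C) :
    ∃ e : E 4, ‖e‖ = 1 ∧ ∀ z, y + z ∈ C ↔ 2 * ⟪z, e⟫ ^ 2 = ‖z‖ ^ 2 := by
  obtain ⟨f, hf⟩ := h
  refine ⟨f.symm (EuclideanSpace.single 3 1), by simp, fun z => ?_⟩
  have h1 : y + z ∈ C ↔ f z ∈ stdKP 4 (le_refl 4) := by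
    have : z ∈ {z : E 4 | y + z ∈ C} ↔ z ∈ f ⁻¹' stdKP 4 (le_refl 4) := by rw [hf]
    exact this
  rw [h1]
  have h2 : ⟪z, f.symm (EuclideanSpace.single 3 1)⟫ = f z 3 := by
    rw [← f.inner_map_map]
    simp [EuclideanSpace.inner_single_right]
  rw [h2, ← f.norm_map z, EuclideanSpace.real_norm_sq_eq, Fin.sum_univ_four]
  have h3 : (f z ∈ stdKP 4 (le_refl 4)) ↔ (f z 3) ^ 2 = (f z 0) ^ 2 + (f z 1) ^ 2 + (f z 2) ^ 2 :=
    Iff.rfl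
  rw [h3]
  constructor <;> intro h <;> linarith

lemma kp_param {y x : E 4} {C : Set (E 4)} (h : IsKPCone (le_refl 4) y C) (hx : x ∈ C) :
    ∃ e w : E 4, ‖e‖ = 1 ∧ 2 * ⟪w, e⟫ ^ 2 = ‖w‖ ^ 2 ∧
      ∀ v, x + v ∈ C ↔ ‖v‖ ^ 2 - 2 * ⟪v, e⟫ ^ 2 = 2 * ⟪v, w⟫ := by
  obtain ⟨e, he, hq⟩ := kp_quad h
  have hee : ⟪e, e⟫ = 1 := by rw [real_inner_self_eq_norm_sq, he]; norm_num
  obtain ⟨u, rfl⟩ : ∃ u, x = y + u := ⟨x - y, by abel⟩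
  have hu := (hq u).1 hx
  refine ⟨e, (2 * ⟪u, e⟫) • e - u, he, ?_, fun v => ?_⟩
  · rw [← real_inner_self_eq_norm_sq] at hu ⊢
    simp only [inner_sub_left, inner_sub_right, inner_smul_left, inner_smul_right, hee,
      real_inner_comm u e] at hu ⊢
    simp only [conj_trivial]
    linarith
  · rw [add_assoc, hq]
    rw [← real_inner_self_eq_norm_sq] at hu ⊢
    rw [← real_inner_self_eq_norm_sq]
    simp only [inner_add_left, inner_add_right, inner_sub_right, inner_smul_right]
    rw [real_inner_comm u v]
    constructor <;> intro h <;> nlinarith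

lemma exists_perp (W : Submodule ℝ (E 4)) (hW : finrank ℝ W = 3) (e : E 4) (ρ : ℝ) (hρ : 0 < ρ) :
    ∃ v ∈ W, ⟪v, e⟫ = 0 ∧ ‖v‖ = ρ := by
  have h1 : LinearMap.ker ((innerₛₗ ℝ e).comp W.subtype) ≠ ⊥ := by
    apply LinearMap.ker_ne_bot_of_finrank_lt
    rw [hW]; simp
  obtain ⟨v, hv, hv0⟩ := Submodule.exists_mem_ne_zero_of_ne_bot h1
  have hv' : ⟪e, (v : E 4)⟫ = 0 := by simpa using hv
  have hn : ‖(v : E 4)‖ ≠ 0 := by simpa using hv0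
  refine ⟨(ρ / ‖(v : E 4)‖) • (v : E 4), W.smul_mem _ v.2, ?_, ?_⟩
  · rw [inner_smul_left, real_inner_comm, hv', mul_zero]
  · rw [norm_smul, Real.norm_eq_abs, abs_of_nonneg (by positivity), div_mul_cancel₀ _ hn]

lemma vertex_far {v d₁ d₂ e w : E 4} {ρ κ : ℝ} (hρ : 0 < ρ) (hκ : 0 < κ) (hκ' : κ ≤ 1 / 6)
    (he : ‖e‖ = 1) (hve : ⟪v, e⟫ = 0) (hv : ‖v‖ = ρ) (h1 : ‖d₁‖ ≤ κ * ρ) (h2 : ‖d₂‖ ≤ κ * ρ)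
    (q1 : ‖v + d₁‖ ^ 2 - 2 * ⟪v + d₁, e⟫ ^ 2 = 2 * ⟪v + d₁, w⟫)
    (q2 : ‖-v + d₂‖ ^ 2 - 2 * ⟪-v + d₂, e⟫ ^ 2 = 2 * ⟪-v + d₂, w⟫) :
    ρ ≤ 4 * κ * ‖w‖ := by
  have a1 : ρ - κ * ρ ≤ ‖v + d₁‖ := by
    have := norm_sub_le_norm_add v d₁; linarith
  have a2 : ρ - κ * ρ ≤ ‖-v + d₂‖ := by
    have := norm_sub_le_norm_add (-v) d₂; rw [norm_neg] at this; linarith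
  have hpos : 0 ≤ ρ - κ * ρ := by nlinarith
  have b1 := pow_le_pow_left₀ hpos a1 2
  have b2 := pow_le_pow_left₀ hpos a2 2
  have c1 : ⟪d₁, e⟫ ^ 2 ≤ (κ * ρ) ^ 2 := by
    rw [← sq_abs]; apply pow_le_pow_left₀ (abs_nonneg _)
    have := abs_real_inner_le_norm d₁ e; rw [he] at this; linarith
  have c2 : ⟪d₂, e⟫ ^ 2 ≤ (κ * ρ) ^ 2 := by
    rw [← sq_abs]; apply pow_le_pow_left₀ (abs_nonneg _)
    have := abs_real_inner_le_norm d₂ e; rw [he] at this; linarith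
  have g1 : ⟪d₁, w⟫ ≤ κ * ρ * ‖w‖ :=
    (real_inner_le_norm d₁ w).trans (by gcongr)
  have g2 : ⟪d₂, w⟫ ≤ κ * ρ * ‖w‖ :=
    (real_inner_le_norm d₂ w).trans (by gcongr)
  simp only [inner_add_left, inner_neg_left, hve] at q1 q2
  have key : 2 * (ρ - κ * ρ) ^ 2 - 4 * (κ * ρ) ^ 2 ≤ 4 * (κ * ρ * ‖w‖) := by nlinarith
  have key2 : ρ * (ρ * (1 - 2 * κ - κ ^ 2)) ≤ ρ * (2 * κ * ‖w‖) := by nlinarith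
  have key3 := le_of_mul_le_mul_left key2 hρ
  nlinarith

/-- Solving for the point of the cone above a point of the tangent plane. -/
lemma solve_cone {e w v : E 4} {σ : ℝ} (hσ : 0 < σ) (he : ‖e‖ = 1) (hR : 4 * σ ≤ ‖w‖)
    (hw : 2 * ⟪w, e⟫ ^ 2 = ‖w‖ ^ 2) (hvw : ⟪v, w⟫ = 0) (hv : ‖v‖ ≤ σ) :
    ∃ d : E 4, ‖d‖ ≤ σ ^ 2 / ‖w‖ ∧
      ‖v + d‖ ^ 2 - 2 * ⟪v + d, e⟫ ^ 2 = 2 * ⟪v + d, w⟫ := by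
  have hRp : 0 < ‖w‖ := by linarith
  set a := ⟪v, e⟫
  set b := ⟪w, e⟫
  set R := ‖w‖
  have ha : |a| ≤ σ := by
    have := abs_real_inner_le_norm v e; rw [he, mul_one] at this; exact this.trans hv
  have hb : |b| ≤ R := by
    have := abs_real_inner_le_norm w e; rwa [he, mul_one] at this
  have hab : |a * b| ≤ σ * R := by rw [abs_mul]; gcongr
  have ha2 : a ^ 2 ≤ ‖v‖ ^ 2 := by
    rw [← sq_abs]; apply pow_le_pow_left₀ (abs_nonneg _)
    have := abs_real_inner_le_norm v e; rwa [he, mul_one] at this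
  have hv2 : ‖v‖ ^ 2 ≤ σ ^ 2 := pow_le_pow_left₀ (norm_nonneg _) hv 2
  have hQ : |‖v‖ ^ 2 - 2 * a ^ 2| ≤ σ ^ 2 := by
    rw [abs_le]; constructor <;> nlinarith [sq_nonneg a]
  -- d = t w, |v|^2 + t^2 R^2 - 2 (a + t b)^2 = 2 t R^2
  have hden : R ^ 2 ≤ 2 * R ^ 2 + 4 * a * b := by
    have := (abs_le.1 hab).1; nlinarith
  set D := 2 * R ^ 2 + 4 * a * b
  have hD : 0 < D := by nlinarith
  refine ⟨((‖v‖ ^ 2 - 2 * a ^ 2) / D) • w, ?_, ?_⟩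
  · rw [norm_smul, Real.norm_eq_abs, abs_div, abs_of_pos hD]
    change |‖v‖ ^ 2 - 2 * a ^ 2| / D * R ≤ _
    calc |‖v‖ ^ 2 - 2 * a ^ 2| / D * R ≤ σ ^ 2 / R ^ 2 * R := by gcongr
      _ = σ ^ 2 / R := by field_simp
  · set t := (‖v‖ ^ 2 - 2 * a ^ 2) / D with ht
    have htD : t * D = ‖v‖ ^ 2 - 2 * a ^ 2 := by rw [ht]; field_simp
    have e1 : ⟪v + t • w, e⟫ = a + t * b := by
      rw [inner_add_left, inner_smul_left]; rfl
    have e2 : ⟪v + t • w, w⟫ = t * R ^ 2 := by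
      rw [inner_add_left, inner_smul_left, hvw, real_inner_self_eq_norm_sq]; simp [R]
    have e3 : ‖v + t • w‖ ^ 2 = ‖v‖ ^ 2 + t ^ 2 * R ^ 2 := by
      rw [norm_add_sq_real, inner_smul_right, hvw, norm_smul, mul_pow, Real.norm_eq_abs, sq_abs]
      simp [R]
    rw [e1, e2, e3]
    simp only [D] at htD
    nlinarith

lemma finrank_perp {w : E 4} (hw : w ≠ 0) : finrank ℝ ((ℝ ∙ w)ᗮ : Submodule ℝ (E 4)) = 3 := by
  have h1 := Submodule.finrank_add_finrank_orthogonal (ℝ ∙ w)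
  rw [finrank_span_singleton hw] at h1
  simp at h1
  omega

instance planes_nonempty (x : E 4) :
    Nonempty {L : AffineSubspace ℝ (E 4) // x ∈ L ∧ Module.finrank ℝ L.direction = 3} :=
  ⟨⟨AffineSubspace.mk' x (ℝ ∙ (EuclideanSpace.single 0 1 : E 4))ᗮ, AffineSubspace.self_mem_mk' _ _, by
    rw [AffineSubspace.direction_mk']; apply finrank_perp; simp⟩⟩

instance cones_nonempty (x : E 4) :
    Nonempty {C : Set (E 4) // (∃ y, IsKPCone (le_refl 4) y C) ∧ x ∈ C} :=
  ⟨⟨{p | p - x ∈ stdKP 4 (le_refl 4)}, ⟨x, LinearIsometryEquiv.refl ℝ _, by ext z; simp⟩, by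
    simp [stdKP]⟩⟩

set_option maxHeartbeats 1600000 in
lemma one_step {S : Set (E 4)} {x : E 4} (hx : x ∈ S) {ρ τ ε : ℝ} (hρ : 0 < ρ) (hτ : 0 < τ)
    (hτ' : τ ≤ 1 / 100) (hε : 0 < ε) (hε' : 200 * ε ≤ τ)
    (hC : varthetaC (le_refl 4) S x ρ < ε) (hP : thetaP 3 S x ρ < τ) (t : ℝ) (ht : 1 / 32 ≤ t)
    (ht1 : t ≤ 1) : thetaP 3 S x (t * ρ) ≤ 8 * t * (τ + ε) + 64 * ε := by
  have ht0 : 0 < t := by linarith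
  obtain ⟨⟨C, ⟨y, hy⟩, hxC⟩, hSC⟩ := exists_lt_of_ciInf_lt hC
  obtain ⟨⟨L, hxL, hL⟩, hSL⟩ := exists_lt_of_ciInf_lt hP
  simp only [Dxr, max_lt_iff] at hSC hSL
  obtain ⟨e, w, he, hw, hq⟩ := kp_param hy hxC
  have hLC : ∀ v ∈ L.direction, ‖v‖ ≤ ρ → ∃ d, ‖d‖ ≤ (τ + ε) * ρ ∧ x + (v + d) ∈ C := by
    intro v hv hvρ
    obtain ⟨s, hs, hsr, hsd⟩ := dxr_lt_ex hρ hx hSL.2 (v + x)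
      (by simpa using AffineSubspace.vadd_mem_of_mem_direction hv hxL) (by simpa using hvρ)
    obtain ⟨c, hc, hcr, hcd⟩ := dxr_lt_ex hρ hxC hSC.1 s hs hsr
    refine ⟨c - (v + x), ?_, by convert hc using 1; abel⟩
    have : c - (v + x) = -((v + x - s) + (s - c)) := by abel
    rw [this, norm_neg]
    have := norm_add_le (v + x - s) (s - c)
    linarith
  have hR : ρ ≤ 4 * (τ + ε) * ‖w‖ := by
    obtain ⟨v, hvL, hve, hvn⟩ := exists_perp L.direction hL e ρ hρ
    obtain ⟨d₁, hd₁, hc₁⟩ := hLC v hvL hvn.le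
    obtain ⟨d₂, hd₂, hc₂⟩ := hLC (-v) (neg_mem hvL) (by rw [norm_neg, hvn])
    exact vertex_far hρ (by linarith) (by linarith) he hve hvn hd₁ hd₂ ((hq _).1 hc₁) ((hq _).1 hc₂)
  have hRp : 0 < ‖w‖ := by
    by_contra hh
    have : ‖w‖ = 0 := le_antisymm (not_lt.1 hh) (norm_nonneg _)
    rw [this] at hR; linarith
  have hw0 : w ≠ 0 := norm_pos_iff.1 hRp
  set κ := τ + ε with hκ
  have hκs : κ ≤ 1 / 90 := by linarith
  have hκ0 : 0 < κ := by linarith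
  have hbd : BddBelow (Set.range fun L : {L : AffineSubspace ℝ (E 4) //
      x ∈ L ∧ Module.finrank ℝ L.direction = 3} => Dxr x (t * ρ) S (L.1 : Set (E 4))) :=
    ⟨0, by rintro _ ⟨L, rfl⟩; exact le_max_of_le_left (dxr_nonneg (by positivity))⟩
  refine (ciInf_le hbd ⟨AffineSubspace.mk' x (ℝ ∙ w)ᗮ, AffineSubspace.self_mem_mk' _ _, by
    rw [AffineSubspace.direction_mk']; exact finrank_perp hw0⟩).trans ?_
  have hσ : 0 < t * ρ := by positivity
  have hc0 : 0 ≤ 8 * t * κ + 64 * ε := by positivity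
  have htε : ε ≤ 32 * t * ε := by nlinarith
  have hmem : ∀ p, p ∈ AffineSubspace.mk' x (ℝ ∙ w)ᗮ ↔ ⟪p - x, w⟫ = 0 := by
    intro p
    rw [AffineSubspace.mem_mk', vsub_eq_sub, Submodule.mem_orthogonal_singleton_iff_inner_left]
  have hdiv : ∀ a : ℝ, 0 ≤ a → a * ρ / ‖w‖ ≤ a * (4 * κ) := by
    intro a ha
    rw [div_le_iff₀ hRp]; nlinarith
  apply max_le
  · apply dxr_le_of hσ hc0
    intro a ha har
    obtain ⟨c, hc, hcr, hcd⟩ := dxr_lt_ex hρ hxC hSC.1 a ha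
      (har.trans (mul_le_of_le_one_left hρ.le ht1))
    set u := a - x with hu
    refine ⟨x + (u - (⟪u, w⟫ / ‖w‖ ^ 2) • w), ?_, ?_, ?_⟩
    · change _ ∈ AffineSubspace.mk' x (ℝ ∙ w)ᗮ
      rw [hmem, add_sub_cancel_left, inner_sub_left, inner_smul_left, real_inner_self_eq_norm_sq]
      simp; field_simp; simp
    · rw [add_sub_cancel_left]
      refine le_trans ?_ har
      apply le_of_sq_le_sq _ (norm_nonneg _)
      rw [norm_sub_sq_real, norm_smul, inner_smul_right, mul_pow, Real.norm_eq_abs, sq_abs]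
      have : (⟪u, w⟫ / ‖w‖ ^ 2) ^ 2 * ‖w‖ ^ 2 = ⟪u, w⟫ / ‖w‖ ^ 2 * ⟪u, w⟫ := by field_simp
      rw [this]
      have : 0 ≤ ⟪u, w⟫ / ‖w‖ ^ 2 * ⟪u, w⟫ := by rw [div_mul_eq_mul_div, ← sq]; positivity
      linarith
    · have e1 : a - (x + (u - (⟪u, w⟫ / ‖w‖ ^ 2) • w)) = (⟪u, w⟫ / ‖w‖ ^ 2) • w := by
        rw [hu]; abel
      have e2 : ‖(⟪u, w⟫ / ‖w‖ ^ 2) • w‖ = |⟪u, w⟫| / ‖w‖ := by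
        rw [norm_smul, Real.norm_eq_abs, abs_div, abs_of_pos (by positivity : 0 < ‖w‖ ^ 2)]
        field_simp
      rw [e1, e2]
      set v := c - x with hv
      have hvc := (hq v).1 (by convert hc using 1; rw [hv]; abel)
      have huv : ‖u - v‖ < ε * ρ := by rw [hu, hv]; simpa using hcd
      have hvn : ‖v‖ ≤ 2 * t * ρ := by
        have : v = u - (u - v) := by abel
        rw [this]
        have := norm_sub_le u (u - v)
        nlinarith
      have hvn2 : ‖v‖ ^ 2 ≤ (2 * t * ρ) ^ 2 := pow_le_pow_left₀ (norm_nonneg _) hvn 2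
      have ha2 : ⟪v, e⟫ ^ 2 ≤ ‖v‖ ^ 2 := by
        rw [← sq_abs]; apply pow_le_pow_left₀ (abs_nonneg _)
        have := abs_real_inner_le_norm v e; rwa [he, mul_one] at this
      have h3 : |⟪v, w⟫| ≤ 2 * (t * ρ) ^ 2 := by
        rw [abs_le]; constructor <;> nlinarith [sq_nonneg ⟪v, e⟫]
      have h4 : |⟪u - v, w⟫| ≤ ε * ρ * ‖w‖ :=
        (abs_real_inner_le_norm _ _).trans (by gcongr)
      have h5 : |⟪u, w⟫| ≤ 2 * (t * ρ) ^ 2 + ε * ρ * ‖w‖ := by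
        have : ⟪u, w⟫ = ⟪v, w⟫ + ⟪u - v, w⟫ := by rw [inner_sub_left u v w]; ring
        rw [this]
        exact (abs_add_le _ _).trans (by linarith)
      rw [div_le_iff₀ hRp]
      refine h5.trans ?_
      have h6 : (t * ρ) * (t * ρ) ≤ (t * ρ) * (t * (4 * κ * ‖w‖)) := by gcongr
      have h7 : ε * (ρ * ‖w‖) ≤ 32 * t * ε * (ρ * ‖w‖) := by gcongr
      have h8 : 0 ≤ t * ε * (ρ * ‖w‖) := by positivity
      linarith
  · apply dxr_le_of hσ hc0
    intro p hp hpr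
    have hp' : ⟪p - x, w⟫ = 0 := (hmem p).1 hp
    set v := p - x with hv
    set μ := 4 * t * κ + 32 * ε with hμ
    have hμ0 : 0 ≤ μ := by positivity
    have hμ1 : μ ≤ 1 := by nlinarith
    have hn1 : ‖(1 - μ) • v‖ ≤ (1 - μ) * (t * ρ) := by
      rw [norm_smul, Real.norm_eq_abs, abs_of_nonneg (by linarith)]
      gcongr
    have hn2 : (1 - μ) * (t * ρ) ≤ t * ρ := by nlinarith
    obtain ⟨d, hd, hdq⟩ := solve_cone (e := e) (w := w) (v := (1 - μ) • v) (σ := t * ρ) hσ he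
      (by nlinarith) hw (by rw [inner_smul_left, hp', mul_zero]) (hn1.trans hn2)
    have hdn : ‖d‖ ≤ 4 * t * κ * (t * ρ) := by
      refine hd.trans ?_
      have := hdiv (t * (t * ρ)) (by positivity)
      calc _ = t * (t * ρ) * ρ / ‖w‖ := by ring
        _ ≤ _ := this
        _ = _ := by ring
    have hcC := (hq _).2 hdq
    have hεt : ε * ρ ≤ 32 * ε * (t * ρ) := by nlinarith
    have hcn : ‖(1 - μ) • v + d‖ + ε * ρ ≤ t * ρ := by
      have := norm_add_le ((1 - μ) • v) d
      rw [hμ] at this hn1 ⊢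
      nlinarith
    obtain ⟨s, hs, hsr, hsd⟩ := dxr_lt_ex hρ hx hSC.2 _ hcC
      (by rw [add_sub_cancel_left]; nlinarith)
    refine ⟨s, hs, ?_, ?_⟩
    · have : s - x = ((1 - μ) • v + d) - (x + ((1 - μ) • v + d) - s) := by abel
      rw [this]
      refine (norm_sub_le _ _).trans ?_
      linarith
    · have : p - s = μ • v + (-d + (x + ((1 - μ) • v + d) - s)) := by
        rw [sub_smul, one_smul, hv]; abel
      rw [this]
      refine (norm_add_le _ _).trans ?_
      have h1 := norm_add_le (-d) (x + ((1 - μ) • v + d) - s)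
      rw [norm_neg] at h1
      have h2 : ‖μ • v‖ ≤ μ * (t * ρ) := by
        rw [norm_smul, Real.norm_eq_abs, abs_of_nonneg hμ0]; gcongr
      rw [hμ] at h2 h1 ⊢
      nlinarith

/-- Corollary 2.11 / `KPflat2`: if a set in `ℝ⁴` is well approximated by
KP cones at all scales below `r` at `x`, and is flat at scale `r`, then it is flat at all
scales below `r`. -/
theorem flat_improvement_from_kp_approx (δ : ℝ) (hδ : 0 < δ) :
    ∃ ε η : ℝ, 0 < ε ∧ 0 < η ∧
      ∀ S : Set (E 4), ∀ x ∈ S, ∀ r : ℝ, 0 < r →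
        (∀ r' : ℝ, 0 < r' → r' ≤ r → varthetaC (le_refl 4) S x r' < ε) →
        thetaP 3 S x r < η →
        ∀ r' : ℝ, 0 < r' → r' ≤ r → thetaP 3 S x r' < δ := by
  set τ := min (δ / 10) (1 / 100) with hτd
  have hτ : 0 < τ := lt_min (by linarith) (by norm_num)
  have hτ1 : τ ≤ 1 / 100 := min_le_right _ _
  have hτ2 : τ ≤ δ / 10 := min_le_left _ _
  refine ⟨τ / 200, τ, by positivity, hτ, ?_⟩
  intro S x hx r hr hC hP
  have hiter : ∀ k : ℕ, thetaP 3 S x ((1 / 32) ^ k * r) < τ := by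
    intro k
    induction k with
    | zero => simpa using hP
    | succ k ih =>
      have hk : (1 / 32 : ℝ) ^ k ≤ 1 := pow_le_one₀ (by norm_num) (by norm_num)
      have := one_step hx (ρ := (1 / 32) ^ k * r) (by positivity) hτ hτ1
        (by positivity : 0 < τ / 200) (by linarith)
        (hC _ (by positivity) (mul_le_of_le_one_left hr.le hk)) ih (1 / 32) le_rfl (by norm_num)
      rw [pow_succ', mul_assoc]
      linarith
  intro r' hr' hr'r
  obtain ⟨k, hk1, hk2⟩ := exists_nat_pow_near_of_lt_one (x := r' / r) (y := (1 / 32 : ℝ))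
    (by positivity) ((div_le_one hr).2 hr'r) (by norm_num) (by norm_num)
  have hk : (1 / 32 : ℝ) ^ k ≤ 1 := pow_le_one₀ (by norm_num) (by norm_num)
  have hp : (0 : ℝ) < (1 / 32) ^ k := by positivity
  rw [lt_div_iff₀ hr] at hk1
  rw [div_le_iff₀ hr] at hk2
  have := one_step hx (ρ := (1 / 32) ^ k * r) (by positivity) hτ hτ1
    (by positivity : 0 < τ / 200) (by linarith)
    (hC _ (by positivity) (mul_le_of_le_one_left hr.le hk)) (hiter k)
    (r' / ((1 / 32) ^ k * r))
    (by rw [le_div_iff₀ (by positivity)]; rw [pow_succ'] at hk1; linarith)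
    ((div_le_one (by positivity)).2 hk2)
  rw [div_mul_cancel₀ _ (by positivity)] at this
  have h1 : r' / ((1 / 32) ^ k * r) ≤ 1 := (div_le_one (by positivity)).2 hk2
  nlinarith
end
end

section
/- For every σ > 0 and every 0 < s ≤ 1/2 there exists η = η(σ,s) > 0 with the following property. Let Σ ⊆ ℝ⁴ be a closed set, x ∈ Σ, and C a KP cone based at x. If y ∈ Σ satisfies D^{x, 3|x−y|/2}(Σ,C) < η, then D^{y, s|x−y|}(Σ,C) < σ. -/
open Metric Set MeasureTheory Filter Module
open scoped RealInnerProductSpace Topology Pointwise ENNReal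

noncomputable section

theorem kpx_setD_le {n : ℕ} (A B : Set (E n)) (K : ℝ) (hK : 0 ≤ K)
    (h : ∀ a ∈ A, infDist a B ≤ K) : setD A B ≤ K := by
  unfold setD
  exact Real.iSup_le (fun a => Real.iSup_le (fun ha => h a ha) hK) hK

theorem kpx_setD_lt {n : ℕ} (A B : Set (E n)) (K : ℝ) (hA : Bornology.IsBounded A)
    (hB : B.Nonempty) (h : setD A B < K) : ∀ a ∈ A, ∃ b ∈ B, dist a b < K := by
  intro a ha
  rw [← Metric.infDist_lt_iff hB]
  refine lt_of_le_of_lt ?_ h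
  obtain ⟨b, hb⟩ := hB
  obtain ⟨M, hM⟩ := hA.subset_closedBall b
  unfold setD
  have hbdd : BddAbove (range fun a => ⨆ (_ : a ∈ A), infDist a B) := by
    refine ⟨max M 0, ?_⟩
    rintro _ ⟨z, rfl⟩
    refine Real.iSup_le (fun hz => ?_) (le_max_right _ _)
    exact ((infDist_le_dist_of_mem hb).trans (mem_closedBall.1 (hM hz))).trans (le_max_left _ _)
  have h1 := le_ciSup hbdd a
  simpa [ha] using h1

theorem kpx_core {V : Type*} [NormedAddCommGroup V] [InnerProductSpace ℝ V] (v w : V) (l : ℝ)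
    (hl0 : 0 ≤ l) (hl : l ≤ 1 / 8) (hw : 0 < ‖w‖) (h : 2 * ‖v‖ ≤ 5 * ‖w‖) :
    ‖(w + l • (v - w)) - v‖ ^ 2 + (‖w + l • (v - w)‖ - ‖v‖) ^ 2
      ≤ (1 - l / 4) * (‖w - v‖ ^ 2 + (‖w‖ - ‖v‖) ^ 2) := by
  set g := ‖w + l • (v - w)‖ with hg
  set r := ‖v‖ with hr
  set q := ‖w‖ with hq
  have hr0 : 0 ≤ r := norm_nonneg _
  set i := inner ℝ v w with hi
  have e1 : ‖(w + l • (v - w)) - v‖ ^ 2 = (1 - l) ^ 2 * ‖w - v‖ ^ 2 := by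
    have : (w + l • (v - w)) - v = (1 - l) • (w - v) := by module
    rw [this, norm_smul, mul_pow, Real.norm_eq_abs, sq_abs]
  have e2 : ‖w - v‖ ^ 2 = q ^ 2 - 2 * i + r ^ 2 := by
    rw [norm_sub_sq_real, real_inner_comm]
  have e0 : inner ℝ (v - w) w = i - q ^ 2 := by
    rw [inner_sub_left, real_inner_self_eq_norm_sq]
  have e3 : g ^ 2 = q ^ 2 + 2 * l * (i - q ^ 2) + l ^ 2 * (q ^ 2 - 2 * i + r ^ 2) := by
    rw [hg, norm_add_sq_real, norm_smul, mul_pow, Real.norm_eq_abs, sq_abs, norm_sub_rev v w, e2,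
      real_inner_smul_right, real_inner_comm, e0]
    ring
  have e4 : q ^ 2 + l * (i - q ^ 2) ≤ g * q := by
    have := real_inner_le_norm (w + l • (v - w)) w
    rw [inner_add_left, real_inner_smul_left, e0, real_inner_self_eq_norm_sq] at this
    exact this
  have hD : 0 ≤ q ^ 2 - 2 * i + r ^ 2 := by rw [← e2]; positivity
  have e5 := mul_le_mul_of_nonneg_left e4 (by positivity : 0 ≤ 2 * r)
  rw [e1, e2]
  set D := q ^ 2 - 2 * i + r ^ 2 with hDdef
  have hi2 : i = (q ^ 2 + r ^ 2 - D) / 2 := by rw [hDdef]; ring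
  rw [hi2] at e3 e5
  clear_value D
  refine le_of_mul_le_mul_left ?_ hw
  have a1 : 0 ≤ l * D * (5 * q - 2 * r) := by
    apply mul_nonneg (by positivity); linarith
  have a2 : 0 ≤ l * D * q * (1 / 8 - l) := by
    apply mul_nonneg (by positivity); linarith
  have a3 : 0 ≤ l * (q - r) ^ 2 * (r + 3 / 4 * q) := by positivity
  have : q * ((1 - l) ^ 2 * D + (g - r) ^ 2) =
    q * ((1 - l) ^ 2 * D) + q * g ^ 2 + q * r ^ 2 - 2 * r * (g * q) := by ring
  rw [this, e3]
  nlinarith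

/-- The first three coordinates. -/
def kpx_pr (p : E 4) : E 3 := !₂[p 0, p 1, p 2]

/-- Point of `ℝ⁴` with given coordinates. -/
def kpx_mk (v : E 3) (t : ℝ) : E 4 := !₂[v 0, v 1, v 2, t]

theorem kpx_norm (p : E 4) : ‖p‖ ^ 2 = ‖kpx_pr p‖ ^ 2 + (p 3) ^ 2 := by
  simp [EuclideanSpace.norm_sq_eq, Fin.sum_univ_four, Fin.sum_univ_three, kpx_pr]

theorem kpx_mem (p : E 4) : p ∈ stdKP 4 (le_refl 4) ↔ (p 3) ^ 2 = ‖kpx_pr p‖ ^ 2 := by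
  simp [EuclideanSpace.norm_sq_eq, Fin.sum_univ_three, kpx_pr, stdKP]

theorem kpx_pr_sub (p q : E 4) : kpx_pr (p - q) = kpx_pr p - kpx_pr q := by
  ext i; fin_cases i <;> simp [kpx_pr]

theorem kpx_pr_mk (v : E 3) (t : ℝ) : kpx_pr (kpx_mk v t) = v := by
  ext i; fin_cases i <;> simp [kpx_pr, kpx_mk]

theorem kpx_mk_three (v : E 3) (t : ℝ) : kpx_mk v t 3 = t := by
  simp [kpx_mk]

theorem kpx_shift (p c : E 4) (hp : p ∈ stdKP 4 (le_refl 4)) (hc : c ∈ stdKP 4 (le_refl 4))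
    (hp0 : 0 < ‖p‖) (h : ‖c - p‖ ≤ 3 / 5 * ‖p‖) (l : ℝ) (hl0 : 0 ≤ l) (hl : l ≤ 1 / 8) :
    ∃ c' ∈ stdKP 4 (le_refl 4), ‖c' - c‖ ≤ 2 * l * ‖c - p‖ ∧
      ‖c' - p‖ ≤ (1 - l / 8) * ‖c - p‖ := by
  rw [kpx_mem] at hp hc
  set v := kpx_pr p with hv
  set w := kpx_pr c with hw
  have np : ‖p‖ ^ 2 = 2 * ‖v‖ ^ 2 := by rw [kpx_norm, hp]; ring
  have ncp : ‖c - p‖ ^ 2 = ‖w - v‖ ^ 2 + (c 3 - p 3) ^ 2 := by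
    rw [kpx_norm, kpx_pr_sub]; simp [hv, hw]
  have hsq : ‖c - p‖ ^ 2 ≤ 18 / 25 * ‖v‖ ^ 2 := by
    have := pow_le_pow_left₀ (norm_nonneg _) h 2
    rw [mul_pow, np] at this
    linarith
  have hr : 0 < ‖v‖ := by
    have : 0 < ‖p‖ ^ 2 := by positivity
    have h0 := norm_nonneg v
    by_contra hcon
    have : ‖v‖ = 0 := le_antisymm (not_lt.1 hcon) h0
    rw [this] at np
    linarith
  have hd2 : ‖w - v‖ ^ 2 = ‖w‖ ^ 2 - 2 * inner ℝ w v + ‖v‖ ^ 2 := norm_sub_sq_real w v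
  have hcs := real_inner_le_norm w v
  have hw0 := norm_nonneg w
  have hq : 2 * ‖v‖ ≤ 5 * ‖w‖ := by
    have h1 : (‖w‖ - ‖v‖) ^ 2 ≤ ‖w - v‖ ^ 2 := by nlinarith
    have h2 : (‖w‖ - ‖v‖) ^ 2 ≤ (c 3 - p 3) ^ 2 := by
      have h3 : |c 3| = ‖w‖ := by rw [← abs_of_nonneg hw0]; exact (sq_eq_sq_iff_abs_eq_abs _ _).1 hc
      have h4 : |p 3| = ‖v‖ := by rw [← abs_of_nonneg hr.le]; exact (sq_eq_sq_iff_abs_eq_abs _ _).1 hp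
      rw [← h3, ← h4]
      exact sq_le_sq.2 (abs_abs_sub_abs_le _ _)
    have h5 : (‖v‖ - ‖w‖) ^ 2 ≤ (3 / 5 * ‖v‖) ^ 2 := by nlinarith
    have := (abs_le.1 (abs_le_of_sq_le_sq h5 (by positivity))).2
    linarith
  have hwpos : 0 < ‖w‖ := by linarith
  obtain ⟨e, he, hpe, hce⟩ : ∃ e : ℝ, e ^ 2 = 1 ∧ p 3 = e * ‖v‖ ∧ c 3 = e * ‖w‖ := by
    have hneg : ¬ ((c 3 - p 3) ^ 2 = (‖w‖ + ‖v‖) ^ 2) := by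
      intro hh
      rw [ncp, hh, hd2] at hsq
      nlinarith [mul_pos hwpos hr]
    rcases sq_eq_sq_iff_eq_or_eq_neg.1 hp with h1 | h1 <;>
    rcases sq_eq_sq_iff_eq_or_eq_neg.1 hc with h2 | h2
    · exact ⟨1, by norm_num, by simp [h1], by simp [h2]⟩
    · exact absurd (by rw [h1, h2]; ring) hneg
    · exact absurd (by rw [h1, h2]; ring) hneg
    · exact ⟨-1, by norm_num, by simp [h1], by simp [h2]⟩
  have core := kpx_core v w l hl0 hl hwpos hq
  have key : ∀ a b : ℝ, (e * a - e * b) ^ 2 = (a - b) ^ 2 := by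
    intro a b
    have : (e * a - e * b) ^ 2 = e ^ 2 * (a - b) ^ 2 := by ring
    rw [this, he, one_mul]
  have ncp' : ‖c - p‖ ^ 2 = ‖w - v‖ ^ 2 + (‖w‖ - ‖v‖) ^ 2 := by
    rw [ncp, hpe, hce, key]
  set w' := w + l • (v - w) with hw'
  refine ⟨kpx_mk w' (e * ‖w'‖), ?_, ?_, ?_⟩
  · rw [kpx_mem, kpx_pr_mk, kpx_mk_three, mul_pow, he, one_mul]
  · apply le_of_sq_le_sq _ (by positivity)
    rw [kpx_norm, kpx_pr_sub, kpx_pr_mk, PiLp.sub_apply, kpx_mk_three, ← hw, hce, key, mul_pow, ncp']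
    have h1 : ‖w' - w‖ ^ 2 = l ^ 2 * ‖w - v‖ ^ 2 := by
      rw [hw', add_sub_cancel_left, norm_smul, mul_pow, Real.norm_eq_abs, sq_abs, norm_sub_rev]
    have h2 : (‖w'‖ - ‖w‖) ^ 2 ≤ ‖w' - w‖ ^ 2 := by
      apply sq_le_sq.2
      rw [abs_of_nonneg (norm_nonneg (w' - w))]
      exact abs_norm_sub_norm_le _ _
    rw [h1] at h2 ⊢
    nlinarith [sq_nonneg (l * ‖w - v‖), sq_nonneg (l * (‖w‖ - ‖v‖))]
  · apply le_of_sq_le_sq _ (mul_nonneg (by linarith) (norm_nonneg _))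
    rw [kpx_norm, kpx_pr_sub, kpx_pr_mk, PiLp.sub_apply, kpx_mk_three, ← hv, hpe, key, mul_pow, ncp']
    refine core.trans ?_
    apply mul_le_mul_of_nonneg_right _ (by positivity)
    nlinarith [sq_nonneg l]

theorem kpx_shift' (x p c : E 4) (C : Set (E 4)) (hC : IsKPCone (le_refl 4) x C)
    (hp : p ∈ C) (hc : c ∈ C) (hp0 : 0 < ‖p - x‖) (h : ‖c - p‖ ≤ 3 / 5 * ‖p - x‖)
    (l : ℝ) (hl0 : 0 ≤ l) (hl : l ≤ 1 / 8) :
    ∃ c' ∈ C, ‖c' - c‖ ≤ 2 * l * ‖c - p‖ ∧ ‖c' - p‖ ≤ (1 - l / 8) * ‖c - p‖ := by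
  obtain ⟨f, hf⟩ := hC
  have hm : ∀ z, z ∈ C ↔ f (z - x) ∈ stdKP 4 (le_refl 4) := by
    intro z
    have := Set.ext_iff.1 hf (z - x)
    simpa using this
  have hn : ∀ a b : E 4, ‖f (a - x) - f (b - x)‖ = ‖a - b‖ := by
    intro a b
    rw [← map_sub, f.norm_map, sub_sub_sub_cancel_right]
  obtain ⟨c', hc', h1, h2⟩ := kpx_shift (f (p - x)) (f (c - x)) ((hm p).1 hp) ((hm c).1 hc)
    (by rwa [f.norm_map]) (by rwa [hn, f.norm_map]) l hl0 hl
  have hb : f ((f.symm c' + x) - x) = c' := by simp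
  refine ⟨f.symm c' + x, (hm _).2 (by rwa [hb]), ?_, ?_⟩
  · rwa [← hn, hb, ← hn c p]
  · rwa [← hn, hb, ← hn c p]

/-- Lemma 2.12 / `KPflat3`: closeness to a KP cone based at `x` at scale
comparable to `|x−y|` propagates to closeness near the point `y`. -/
theorem kp_approx_propagation (σ s : ℝ) (hσ : 0 < σ) (hs0 : 0 < s) (hs : s ≤ 1 / 2) :
    ∃ η : ℝ, 0 < η ∧
      ∀ S : Set (E 4), IsClosed S → ∀ x ∈ S, ∀ C : Set (E 4),
        IsKPCone (le_refl 4) x C → ∀ y ∈ S,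
          Dxr x (3 * ‖x - y‖ / 2) S C < η → Dxr y (s * ‖x - y‖) S C < σ := by
  obtain ⟨l, hl0, hl, hlσ⟩ : ∃ l : ℝ, 0 < l ∧ l ≤ 1 / 8 ∧ l ≤ σ / 10 :=
    ⟨min (1 / 8) (σ / 10), by positivity, min_le_left _ _, min_le_right _ _⟩
  refine ⟨l * s / 48, by positivity, ?_⟩
  intro S _ x hx C hC y hy hD
  rcases (norm_nonneg (x - y)).eq_or_lt with hR | hR
  · simp [← hR, Dxr, dxr, hσ]
  set R := ‖x - y‖ with hRdef
  have hxC : x ∈ C := by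
    obtain ⟨f, hf⟩ := hC
    have := Set.ext_iff.1 hf 0
    simp [stdKP] at this
    exact this
  obtain ⟨ε, hε⟩ : ∃ ε, ε = l * s * R / 32 := ⟨_, rfl⟩
  have hε0 : 0 < ε := by rw [hε]; positivity
  have hls : l * s ≤ 1 / 16 := by nlinarith
  have hεR : ε ≤ R / 512 := by rw [hε]; nlinarith
  have hεl : ε ≤ s * R / 256 := by
    rw [hε]; nlinarith [mul_pos hs0 hR]
  obtain ⟨hD1, hD2⟩ := max_lt_iff.1 hD
  have conv : ∀ A B : Set (E 4), dxr x (3 * R / 2) A B < l * s / 48 →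
      setD (A ∩ closedBall x (3 * R / 2)) (B ∩ closedBall x (3 * R / 2)) < ε := by
    intro A B h
    unfold dxr at h
    rw [one_div, inv_mul_lt_iff₀ (by positivity)] at h
    rw [hε]; linarith
  have hxb : x ∈ closedBall x (3 * R / 2) := mem_closedBall_self (by positivity)
  have hSC := kpx_setD_lt (S ∩ closedBall x (3 * R / 2)) (C ∩ closedBall x (3 * R / 2)) ε
    (isBounded_closedBall.subset inter_subset_right) ⟨x, hxC, hxb⟩ (conv _ _ hD1)
  have hCS := kpx_setD_lt (C ∩ closedBall x (3 * R / 2)) (S ∩ closedBall x (3 * R / 2)) ε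
    (isBounded_closedBall.subset inter_subset_right) ⟨x, hx, hxb⟩ (conv _ _ hD2)
  have hsR : s * R ≤ R / 2 := by nlinarith
  have hsub : ∀ z, dist z y ≤ s * R → z ∈ closedBall x (3 * R / 2) := by
    intro z hz
    rw [mem_closedBall]
    have h1 := dist_triangle z y x
    have h2 : dist y x = R := by rw [dist_comm, dist_eq_norm]
    linarith
  obtain ⟨p, ⟨hpC, _⟩, hpy⟩ := hSC y ⟨hy, hsub y (by rw [dist_self]; positivity)⟩
  have hpx : R - ε ≤ ‖p - x‖ := by
    rw [← dist_eq_norm]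
    have h1 := dist_triangle y p x
    have h2 : dist y x = R := by rw [dist_comm, dist_eq_norm]
    linarith
  -- the shift of a point of the cone
  have shift : ∀ c ∈ C, dist c y ≤ s * R + ε → ∃ c' ∈ C, dist c' c ≤ 4 * l * (s * R) ∧
      dist c' y ≤ s * R - ε := by
    intro c hc hcy
    have hcp : ‖c - p‖ ≤ s * R + 2 * ε := by
      rw [← dist_eq_norm]
      linarith [dist_triangle c y p]
    obtain ⟨c', hc', h1, h2⟩ := kpx_shift' x p c C hC hpC hc (by linarith) (by linarith) l hl0.le hl
    refine ⟨c', hc', ?_, ?_⟩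
    · rw [dist_eq_norm]
      refine h1.trans ?_
      have : ‖c - p‖ ≤ 2 * (s * R) := by linarith
      nlinarith
    · rw [← dist_eq_norm] at h2
      have h3 := dist_triangle c' p y
      rw [dist_comm p y] at h3
      have h4 : (1 - l / 8) * ‖c - p‖ ≤ (1 - l / 8) * (s * R + 2 * ε) :=
        mul_le_mul_of_nonneg_left hcp (by linarith)
      have h5 : 0 ≤ l * ε := by positivity
      have h6 : l * (s * R) = 32 * ε := by rw [hε]; ring
      nlinarith
  have hK : 4 * l * (s * R) + ε ≤ σ / 2 * (s * R) := by
    have h6 : l * (s * R) = 32 * ε := by rw [hε]; ring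
    nlinarith [mul_le_mul_of_nonneg_right hlσ (mul_pos hs0 hR).le]
  have fin : ∀ A B : Set (E 4), (∀ a ∈ A, dist a y ≤ s * R → ∃ b ∈ B, dist b y ≤ s * R ∧
      dist a b ≤ 4 * l * (s * R) + ε) → dxr y (s * R) A B < σ := by
    intro A B h
    have : setD (A ∩ closedBall y (s * R)) (B ∩ closedBall y (s * R)) ≤ σ / 2 * (s * R) := by
      apply kpx_setD_le _ _ _ (by positivity)
      rintro a ⟨ha, hay⟩
      obtain ⟨b, hb, hby, hab⟩ := h a ha hay
      have hm : b ∈ B ∩ closedBall y (s * R) := ⟨hb, hby⟩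
      exact ((infDist_le_dist_of_mem hm).trans hab).trans hK
    unfold dxr
    rw [one_div, inv_mul_lt_iff₀ (by positivity)]
    nlinarith [mul_pos hσ (mul_pos hs0 hR)]
  refine max_lt (fin _ _ ?_) (fin _ _ ?_)
  · intro a ha hay
    obtain ⟨c, ⟨hc, _⟩, hac⟩ := hSC a ⟨ha, hsub a hay⟩
    obtain ⟨c', hc', h1, h2⟩ := shift c hc (by
      linarith [dist_triangle c a y, dist_comm a c])
    refine ⟨c', hc', by linarith, ?_⟩
    linarith [dist_triangle a c c', dist_comm c c']
  · intro c hc hcy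
    obtain ⟨c', hc', h1, h2⟩ := shift c hc (by linarith)
    obtain ⟨a, ⟨ha, _⟩, hac⟩ := hCS c' ⟨hc', hsub c' (by linarith)⟩
    refine ⟨a, ha, ?_, ?_⟩
    · linarith [dist_triangle a c' y, dist_comm a c']
    · linarith [dist_triangle c c' a, dist_comm c c']
end
end
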